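/- Let δ and d be integers with 2 ≤ δ and 2δ < d, set a := max{4, (δ−1)/2} and D := (2δ−1)·d, and let M' ∈ ℂ^{D×D} be the block-circulant matrix built from the masks m_l as described below. Then M' is invertible, and its ℓ²→ℓ² condition number satisfies κ(M') := ‖M'‖·‖(M')⁻¹‖ < max{144·e², (9·e²/4)·(δ−1)²}, where ‖·‖ denotes the ℓ² operator norm (largest singular value). -/

import Mathlib

/-- The local correlation masks: `(m_l)_i = e^{−i/a}·(2δ−1)^{−1/4}·exp(2πi(i−1)(l−1)/(2δ−1))`
for `1 ≤ i ≤ δ` and `0` for `i > δ` (1-based indices). `mask a δ l i` is `(m_l)_i`. -/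
noncomputable def mask (a : ℝ) (δ : ℕ) (l i : ℕ) : ℂ :=
  if i ≤ δ then
    ((Real.exp (-(i : ℝ) / a) * (2 * (δ : ℝ) - 1) ^ (-(1 / 4 : ℝ)) : ℝ) : ℂ)
      * Complex.exp (2 * Real.pi * Complex.I * ((i : ℂ) - 1) * ((l : ℂ) - 1)
          / (2 * (δ : ℂ) - 1))
  else 0

/-- The blocks `M'_l ∈ ℂ^{(2δ−1)×(2δ−1)}`, `1 ≤ l ≤ δ` (all indices 1-based):
`blk a δ l i j = (M'_l)_{i,j}`. -/
noncomputable def blk (a : ℝ) (δ : ℕ) (l i j : ℕ) : ℂ :=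
  if j ≤ δ - l + 1 then mask a δ i l * (starRingEnd ℂ) (mask a δ i (j + l - 1))
  else if j ≤ 2 * δ - l - 1 then 0
  else if l < δ then mask a δ i (l + 1) * (starRingEnd ℂ) (mask a δ i (l + j - 2 * δ + 1))
  else 0

/-- The block-circulant matrix `M' ∈ ℂ^{D×D}`, `D = (2δ−1)·d`, indexed by pairs
(block index in `{0,…,d−1}` ↔ `{1,…,d}`, inner index in `{0,…,2δ−2}` ↔ `{1,…,2δ−1}`):
the block in block-row `i`, block-column `j` is `M'_l` with `l = ((j−i) mod d) + 1`
when `l ≤ δ`, and zero otherwise. -/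
noncomputable def Mp (a : ℝ) (d δ : ℕ) :
    Matrix (Fin d × Fin (2 * δ - 1)) (Fin d × Fin (2 * δ - 1)) ℂ :=
  fun p q =>
    let l : ℕ := (((q.1 : ℤ) - (p.1 : ℤ)) % (d : ℤ)).toNat + 1
    if l ≤ δ then blk a δ l ((p.2 : ℕ) + 1) ((q.2 : ℕ) + 1) else 0

theorem norm_smul_pow_apply {E : Type*} [NormedAddCommGroup E] [NormedSpace ℂ E]
    (T : Module.End ℂ E) (hT : ∀ x, ‖T x‖ = ‖x‖) {r : ℝ} (hr : 0 ≤ r) (k : ℕ) (x : E) :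
    ‖(((r : ℂ) • T) ^ k) x‖ = r ^ k * ‖x‖ := by
  induction k with
  | zero => simp
  | succ k ih =>
    rw [pow_succ', Module.End.mul_apply, LinearMap.smul_apply, norm_smul, hT, ih,
      Complex.norm_real, Real.norm_of_nonneg hr]
    ring

theorem norm_geom_sum_apply_le {E : Type*} [NormedAddCommGroup E] [NormedSpace ℂ E]
    (T : Module.End ℂ E) (hT : ∀ x, ‖T x‖ = ‖x‖) {r : ℝ} (hr : 0 ≤ r) (hr1 : r < 1)
    (L : ℕ) (x : E) :
    ‖(∑ k ∈ Finset.range L, ((r : ℂ) • T) ^ k) x‖ ≤ (1 - r)⁻¹ * ‖x‖ := by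
  rw [LinearMap.sum_apply]
  refine (norm_sum_le _ _).trans ?_
  simp_rw [norm_smul_pow_apply T hT hr]
  rw [← Finset.sum_mul, ← tsum_geometric_of_lt_one hr hr1]
  gcongr
  exact (summable_geometric_of_lt_one hr hr1).sum_le_tsum _ fun _ _ => by positivity

theorem le_norm_geom_sum_apply {E : Type*} [NormedAddCommGroup E] [NormedSpace ℂ E]
    (T : Module.End ℂ E) (hT : ∀ x, ‖T x‖ = ‖x‖) {r : ℝ} (hr : 0 ≤ r) (hr1 : r < 1)
    {L : ℕ} (hL : 1 ≤ L) (x : E) :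
    (1 - r) / (1 + r) * ‖x‖ ≤ ‖(∑ k ∈ Finset.range L, ((r : ℂ) • T) ^ k) x‖ := by
  set A : Module.End ℂ E := (r : ℂ) • T
  set g := (∑ k ∈ Finset.range L, A ^ k) x
  have hA : ‖A g‖ = r * ‖g‖ := by
    simpa only [pow_one] using norm_smul_pow_apply T hT hr 1 g
  have hg : g - A g = x - (A ^ L) x := by
    simpa only [sub_mul, one_mul, LinearMap.sub_apply, Module.End.mul_apply,
      Module.End.one_apply] using congrArg (fun B : Module.End ℂ E => B x) (mul_neg_geom_sum A L)
  have h1 : ‖x‖ - r ^ L * ‖x‖ ≤ (1 + r) * ‖g‖ := by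
    calc ‖x‖ - r ^ L * ‖x‖ = ‖x‖ - ‖(A ^ L) x‖ := by rw [norm_smul_pow_apply T hT hr]
      _ ≤ ‖x - (A ^ L) x‖ := norm_sub_norm_le _ _
      _ = ‖g - A g‖ := by rw [hg]
      _ ≤ ‖g‖ + ‖A g‖ := norm_sub_le _ _
      _ = (1 + r) * ‖g‖ := by rw [hA]; ring
  have h2 : r ^ L ≤ r := pow_le_of_le_one hr hr1.le (by omega)
  rw [div_mul_eq_mul_div, div_le_iff₀ (by positivity)]
  nlinarith [norm_nonneg x]

theorem Matrix.isUnit_and_norm_mul_norm_inv_le {ι : Type*} [Fintype ι] [DecidableEq ι]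
    (M : Matrix ι ι ℂ) {m B : ℝ} (hm : 0 < m) (hB : 0 ≤ B)
    (hlow : ∀ v, m * ‖v‖ ≤ ‖Matrix.toEuclideanCLM (𝕜 := ℂ) M v‖)
    (hup : ∀ v, ‖Matrix.toEuclideanCLM (𝕜 := ℂ) M v‖ ≤ B * ‖v‖) :
    IsUnit M ∧ ‖Matrix.toEuclideanCLM (𝕜 := ℂ) M‖ * ‖Matrix.toEuclideanCLM (𝕜 := ℂ) M⁻¹‖
      ≤ B * m⁻¹ := by
  have hM : IsUnit M := by
    rw [← Matrix.mulVec_injective_iff_isUnit, ← Matrix.coe_mulVecLin, ← LinearMap.ker_eq_bot,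
      LinearMap.ker_eq_bot']
    intro v hv
    have h := hlow (WithLp.toLp 2 v)
    rw [Matrix.toEuclideanCLM_toLp] at h
    rw [Matrix.mulVecLin_apply] at hv
    rw [hv, WithLp.toLp_zero, norm_zero] at h
    have h0 : ‖WithLp.toLp 2 v‖ ≤ 0 := by
      by_contra! hc
      nlinarith [mul_pos hm hc]
    simpa using h0
  refine ⟨hM, mul_le_mul (ContinuousLinearMap.opNorm_le_bound _ hB hup)
    (ContinuousLinearMap.opNorm_le_bound _ (by positivity) fun u => ?_) (norm_nonneg _) hB⟩
  have h := hlow (Matrix.toEuclideanCLM (𝕜 := ℂ) M⁻¹ u)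
  rw [← mul_apply_eq_comp, ← map_mul, Matrix.mul_nonsing_inv _
    ((Matrix.isUnit_iff_isUnit_det M).1 hM), map_one, one_apply_eq_self] at h
  rwa [inv_mul_eq_div, le_div_iff₀' hm]

theorem Matrix.sum_norm_sq_mulVec_of_conjTranspose_mul_self {n : Type*} [Fintype n]
    [DecidableEq n] {F : Matrix n n ℂ} (hF : F.conjTranspose * F = 1) (w : n → ℂ) :
    ∑ k, ‖(F.mulVec w) k‖ ^ 2 = ∑ j, ‖w j‖ ^ 2 := by
  have key (u : n → ℂ) : ((∑ k, ‖u k‖ ^ 2 : ℝ) : ℂ) = star u ⬝ᵥ u := by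
    simp [dotProduct, Complex.conj_mul']
  have : ((∑ k, ‖(F.mulVec w) k‖ ^ 2 : ℝ) : ℂ) = ((∑ j, ‖w j‖ ^ 2 : ℝ) : ℂ) := by
    rw [key, key, Matrix.star_mulVec, Matrix.dotProduct_mulVec, Matrix.vecMul_vecMul, hF,
      Matrix.vecMul_one]
  exact_mod_cast this

/-- The unitary discrete Fourier matrix of size `n`. -/
noncomputable def dftMatrix (n : ℕ) : Matrix (Fin n) (Fin n) ℂ := fun k j =>
  (((n : ℝ) ^ (-(1 / 2 : ℝ)) : ℝ) : ℂ) *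
    Complex.exp (-(2 * Real.pi * Complex.I * (j : ℕ) * (k : ℕ) / n))

theorem dftMatrix_conjTranspose_mul_self {n : ℕ} (hn : n ≠ 0) :
    (dftMatrix n).conjTranspose * dftMatrix n = 1 := by
  have hnR : (0 : ℝ) < n := by positivity
  have hnC : (n : ℂ) ≠ 0 := by exact_mod_cast hn
  have hc : (((n : ℝ) ^ (-(1 / 2 : ℝ)) : ℝ) : ℂ) * (((n : ℝ) ^ (-(1 / 2 : ℝ)) : ℝ) : ℂ)
      = (n : ℂ)⁻¹ := by
    rw [← Complex.ofReal_mul, ← Real.rpow_add hnR]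
    norm_num [Real.rpow_neg_one]
  ext j j'
  set η : ℂ := Complex.exp (2 * Real.pi * Complex.I * ((j : ℕ) - (j' : ℕ)) / n) with hη
  have hterm (k : Fin n) : (dftMatrix n).conjTranspose j k * dftMatrix n k j'
      = (n : ℂ)⁻¹ * η ^ (k : ℕ) := by
    rw [Matrix.conjTranspose_apply, dftMatrix, dftMatrix, hη, ← Complex.exp_nat_mul, ← hc]
    simp only [star_mul', RCLike.star_def, Complex.conj_ofReal, ← Complex.exp_conj, map_neg,
      map_div₀, map_mul, Complex.conj_I, map_natCast, map_ofNat]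
    rw [mul_mul_mul_comm, ← Complex.exp_add]
    congr 2
    ring
  rw [Matrix.mul_apply, Finset.sum_congr rfl fun k _ => hterm k, ← Finset.mul_sum,
    Fin.sum_univ_eq_sum_range (fun k => η ^ k) n]
  rcases eq_or_ne j j' with rfl | hne
  · simp [hη, hnC]
  · have hη1 : η ≠ 1 := by
      rw [hη, Ne, Complex.exp_eq_one_iff]
      rintro ⟨z, hz⟩
      have h2 : ((j : ℕ) : ℂ) - (j' : ℕ) = z * n := by
        have := Complex.two_pi_I_ne_zero
        field_simp at hz
        linear_combination hz
      have h3 : ((j : ℕ) : ℤ) - (j' : ℕ) = z * n := by exact_mod_cast h2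
      have h4 : ((j : ℕ) : ℤ) - (j' : ℕ) = 0 :=
        Int.eq_zero_of_abs_lt_dvd ⟨z, by rw [h3, mul_comm]⟩ (by rw [abs_lt]; omega)
      exact hne (Fin.ext (by omega))
    have hηn : η ^ n = 1 := by
      rw [hη, ← Complex.exp_nat_mul, Complex.exp_eq_one_iff]
      refine ⟨(j : ℕ) - (j' : ℕ), ?_⟩
      push_cast
      field_simp
    rw [geom_sum_eq hη1, hηn, Matrix.one_apply_ne hne]
    simp

theorem mask_mul_conj_mask (a : ℝ) {δ l l' : ℕ} (hδ : 1 ≤ δ) (k : ℕ) (hl : l ≤ δ)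
    (hl' : l' ≤ δ) :
    mask a δ (k + 1) l * (starRingEnd ℂ) (mask a δ (k + 1) l') =
      ((((2 * δ - 1 : ℕ) : ℝ) ^ (-(1 / 2 : ℝ)) : ℝ) : ℂ) *
        Complex.exp (2 * Real.pi * Complex.I * ((l : ℂ) - l') * k / (2 * δ - 1 : ℕ)) *
        (Real.exp (-((l : ℝ) + l') / a) : ℝ) := by
  have hN : ((2 * δ - 1 : ℕ) : ℝ) = 2 * (δ : ℝ) - 1 := by
    rw [Nat.cast_sub (by omega)]
    push_cast
    ring
  have hNC : ((2 * δ - 1 : ℕ) : ℂ) = 2 * (δ : ℂ) - 1 := by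
    exact_mod_cast congrArg Complex.ofReal hN
  have hpos : (0 : ℝ) < 2 * (δ : ℝ) - 1 := by
    rw [← hN]
    exact_mod_cast (by omega : 0 < 2 * δ - 1)
  have hreal : Real.exp (-(l : ℝ) / a) * (2 * (δ : ℝ) - 1) ^ (-(1 / 4 : ℝ)) *
      (Real.exp (-(l' : ℝ) / a) * (2 * (δ : ℝ) - 1) ^ (-(1 / 4 : ℝ))) =
      (2 * (δ : ℝ) - 1) ^ (-(1 / 2 : ℝ)) * Real.exp (-((l : ℝ) + l') / a) := by
    rw [mul_mul_mul_comm, ← Real.exp_add, ← Real.rpow_add hpos, mul_comm]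
    congr 2 <;> ring
  rw [mask, mask, if_pos hl, if_pos hl', hN, hNC,
    mul_right_comm (Complex.ofReal _) (Complex.exp _) (Complex.ofReal _),
    ← Complex.ofReal_mul (_ ^ _), ← hreal]
  simp only [map_mul, Complex.conj_ofReal, ← Complex.exp_conj, map_div₀, map_sub, Complex.conj_I,
    map_natCast, map_ofNat, map_one]
  rw [mul_mul_mul_comm, ← Complex.exp_add, ← Complex.ofReal_mul]
  congr 2
  push_cast
  ring

theorem exists_blk_eq {a : ℝ} (ha : 0 < a) {δ : ℕ} (hδ : 2 ≤ δ) (j : Fin (2 * δ - 1)) :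
    ∃ (K : ℝ) (p L : ℕ), Real.exp (-((δ : ℝ) + 1) / a) ≤ K ∧ K ≤ Real.exp (-2 / a) ∧ 1 ≤ L ∧
      p + L ≤ δ ∧ ∀ t < δ, ∀ k : Fin (2 * δ - 1), blk a δ (t + 1) (k + 1) (j + 1) =
        dftMatrix (2 * δ - 1) k j *
          ((if p ≤ t ∧ t < p + L then K * Real.exp (-2 / a) ^ (t - p) else 0 : ℝ) : ℂ) := by
  obtain ⟨j, hj⟩ := j
  have hNC : ((2 * δ - 1 : ℕ) : ℂ) ≠ 0 := by exact_mod_cast (by omega : 2 * δ - 1 ≠ 0)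
  rcases lt_or_ge j δ with hjδ | hjδ
  · have hjR : (j : ℝ) + 1 ≤ δ := by exact_mod_cast hjδ
    refine ⟨Real.exp (-((j : ℝ) + 2) / a), 0, δ - j, ?_, ?_, by omega, by omega, ?_⟩
    · exact Real.exp_le_exp.2 (div_le_div_of_nonneg_right (by linarith) ha.le)
    · exact Real.exp_le_exp.2 (div_le_div_of_nonneg_right
        (by linarith [(Nat.cast_nonneg j : (0 : ℝ) ≤ j)]) ha.le)
    intro t ht k
    change blk a δ (t + 1) (k + 1) (j + 1) = _
    by_cases h : t < δ - j
    · rw [blk, if_pos (by omega), if_pos (by omega),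
        mask_mul_conj_mask a (by omega) _ (by omega) (by omega), dftMatrix,
        ← Real.exp_nat_mul, ← Real.exp_add, Nat.sub_zero,
        show j + 1 + (t + 1) - 1 = j + 1 + t by omega]
      push_cast
      congr 2
      · congr 1; ring
      · ring
    · rw [blk, if_neg (by omega), if_neg (show ¬(0 ≤ t ∧ t < 0 + (δ - j)) by omega)]
      simp only [Complex.ofReal_zero, mul_zero]
      split_ifs <;> first | rfl | omega
  · obtain ⟨s, hs⟩ : ∃ s, s + j = 2 * δ - 1 := ⟨2 * δ - 1 - j, by omega⟩
    have hsR : (s : ℝ) + 1 ≤ δ := by exact_mod_cast (by omega : s + 1 ≤ δ)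
    refine ⟨Real.exp (-((s : ℝ) + 2) / a), s - 1, δ - s, ?_, ?_, by omega, by omega, ?_⟩
    · exact Real.exp_le_exp.2 (div_le_div_of_nonneg_right (by linarith) ha.le)
    · exact Real.exp_le_exp.2 (div_le_div_of_nonneg_right
        (by linarith [(Nat.cast_nonneg s : (0 : ℝ) ≤ s)]) ha.le)
    intro t ht k
    change blk a δ (t + 1) (k + 1) (j + 1) = _
    by_cases h : s - 1 ≤ t ∧ t < s - 1 + (δ - s)
    · obtain ⟨q, rfl⟩ : ∃ q, t = s - 1 + q := ⟨t - (s - 1), by omega⟩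
      rw [blk, if_neg (by omega), if_neg (by omega), if_pos (by omega),
        if_pos h, mask_mul_conj_mask a (by omega) _ (by omega) (by omega), dftMatrix,
        ← Real.exp_nat_mul, ← Real.exp_add, show s - 1 + q - (s - 1) = q by omega,
        show s - 1 + q + 1 + 1 = s + q + 1 by omega,
        show s - 1 + q + 1 + (j + 1) - 2 * δ + 1 = q + 1 by omega]
      have hjC : (s : ℂ) = ((2 * δ - 1 : ℕ) : ℂ) - j := by
        rw [← hs]; push_cast; ring
      congr 1
      · congr 1
        rw [Complex.exp_eq_exp_iff_exists_int]
        refine ⟨(k : ℕ), ?_⟩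
        push_cast
        rw [hjC]
        field_simp
        ring
      · congr 2; push_cast; ring
    · rw [blk, if_neg (by omega), if_neg h]
      simp only [Complex.ofReal_zero, mul_zero]
      split_ifs <;> first | rfl | omega

theorem Mp_add_right (a : ℝ) (d δ : ℕ) (i u : Fin d) (k j : Fin (2 * δ - 1)) :
    Mp a d δ (i, k) (i + u, j) =
      if (u : ℕ) + 1 ≤ δ then blk a δ (u + 1) (k + 1) (j + 1) else 0 := by
  have h : ((((i + u : Fin d) : ℕ) : ℤ) - ((i : ℕ) : ℤ)) % (d : ℤ) = (u : ℕ) := by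
    rw [Fin.val_add, Int.natCast_emod, Int.emod_sub_emod, Nat.cast_add, add_sub_cancel_left]
    exact Int.emod_eq_of_lt (by omega) (by omega)
  simp only [Mp, h, Int.toNat_natCast]

/-- The cyclic shift `v ↦ (i ↦ v (i + 1))` on `ℂ^d`. -/
noncomputable def cyclicShift (d : ℕ) [NeZero d] : Module.End ℂ (EuclideanSpace ℂ (Fin d)) :=
  (LinearIsometryEquiv.piLpCongrLeft 2 ℂ ℂ (Equiv.subRight (1 : Fin d))).toLinearEquiv.toLinearMap

theorem norm_cyclicShift (d : ℕ) [NeZero d] (x : EuclideanSpace ℂ (Fin d)) :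
    ‖cyclicShift d x‖ = ‖x‖ :=
  LinearIsometryEquiv.norm_map _ x

theorem cyclicShift_pow_apply (d : ℕ) [NeZero d] (t : ℕ) (x : EuclideanSpace ℂ (Fin d))
    (i : Fin d) : (cyclicShift d ^ t) x i = x (i + Fin.ofNat d t) := by
  induction t generalizing i with
  | zero => simp
  | succ t ih =>
    have h (y : EuclideanSpace ℂ (Fin d)) : cyclicShift d y i = y (i + 1) := rfl
    rw [pow_succ', Module.End.mul_apply, h, ih]
    have hadd : i + 1 + Fin.ofNat d t = i + Fin.ofNat d (t + 1) := by
      ext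
      simp [Fin.val_add, Nat.add_mod, add_comm, add_left_comm]
    rw [hadd]

/-- The `j`-th coordinate, in the inner index, of a vector of blocks. -/
noncomputable def innerSlice {d n : ℕ} (v : EuclideanSpace ℂ (Fin d × Fin n)) (j : Fin n) :
    EuclideanSpace ℂ (Fin d) :=
  WithLp.toLp 2 fun i => v (i, j)

theorem sum_norm_sq_innerSlice {d n : ℕ} (v : EuclideanSpace ℂ (Fin d × Fin n)) :
    ∑ j : Fin n, ‖innerSlice v j‖ ^ 2 = ‖v‖ ^ 2 := by
  simp_rw [EuclideanSpace.norm_sq_eq, Fintype.sum_prod_type_right]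
  rfl

theorem toEuclideanCLM_Mp_apply (a : ℝ) {d δ : ℕ} [NeZero d] (hd : δ ≤ d)
    (v : EuclideanSpace ℂ (Fin d × Fin (2 * δ - 1))) (i : Fin d) (k : Fin (2 * δ - 1)) :
    Matrix.toEuclideanCLM (𝕜 := ℂ) (Mp a d δ) v (i, k) =
      ∑ j : Fin (2 * δ - 1), ∑ t ∈ Finset.range δ,
        blk a δ (t + 1) (k + 1) (j + 1) * (cyclicShift d ^ t) (innerSlice v j) i := by
  rw [Matrix.ofLp_toEuclideanCLM, Matrix.mulVec, dotProduct, Fintype.sum_prod_type_right]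
  refine Finset.sum_congr rfl fun j _ => ?_
  rw [← Equiv.sum_comp (Equiv.addLeft i)]
  let f : ℕ → ℂ := fun t => if t < δ then
    blk a δ (t + 1) (k + 1) (j + 1) * (cyclicShift d ^ t) (innerSlice v j) i else 0
  have hf (u : Fin d) : Mp a d δ (i, k) (Equiv.addLeft i u, j) * v (Equiv.addLeft i u, j) = f u := by
    rw [Equiv.coe_addLeft, Mp_add_right]
    simp only [f, Nat.succ_le_iff, ite_mul, zero_mul, cyclicShift_pow_apply, innerSlice,
      Fin.ofNat_val_eq_self]
  rw [Finset.sum_congr rfl fun u _ => hf u, Fin.sum_univ_eq_sum_range f d,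
    ← Finset.sum_subset (Finset.range_subset_range.2 hd) fun t _ ht => ?_]
  · exact Finset.sum_congr rfl fun t ht => if_pos (Finset.mem_range.1 ht)
  · exact if_neg (by simpa using ht)

theorem sum_range_ite_smul_pow {E : Type*} [AddCommGroup E] [Module ℂ E] (T : Module.End ℂ E)
    (K r : ℝ) {p L δ : ℕ} (h : p + L ≤ δ) (x : E) :
    ∑ t ∈ Finset.range δ, ((if p ≤ t ∧ t < p + L then K * r ^ (t - p) else 0 : ℝ) : ℂ) •
        (T ^ t) x =
      (K : ℂ) • (∑ k ∈ Finset.range L, ((r : ℂ) • T) ^ k) ((T ^ p) x) := by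
  obtain ⟨q, rfl⟩ := Nat.exists_eq_add_of_le h
  rw [Finset.sum_range_add, Finset.sum_range_add, Finset.sum_eq_zero fun t ht => ?_, zero_add,
    Finset.sum_eq_zero (s := Finset.range q) fun t ht => ?_, add_zero, LinearMap.sum_apply,
    Finset.smul_sum]
  · refine Finset.sum_congr rfl fun t ht => ?_
    rw [if_pos ⟨by omega, by simpa using ht⟩, Nat.add_sub_cancel_left, smul_pow,
      LinearMap.smul_apply, ← Module.End.mul_apply, ← pow_add, smul_smul, add_comm p t]
    push_cast
    rfl
  · rw [if_neg (by omega), Complex.ofReal_zero, zero_smul]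
  · rw [if_neg (by have := Finset.mem_range.1 ht; omega), Complex.ofReal_zero, zero_smul]

theorem norm_pow_apply_of_norm_apply {E : Type*} [NormedAddCommGroup E] [NormedSpace ℂ E]
    (T : Module.End ℂ E) (hT : ∀ x, ‖T x‖ = ‖x‖) (p : ℕ) (x : E) : ‖(T ^ p) x‖ = ‖x‖ := by
  simpa using norm_smul_pow_apply T hT zero_le_one p x

theorem exists_toEuclideanCLM_Mp_eq {a : ℝ} (ha : 0 < a) {d δ : ℕ} (hδ : 2 ≤ δ) (hd : δ ≤ d)
    (v : EuclideanSpace ℂ (Fin d × Fin (2 * δ - 1))) :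
    ∃ w : Fin (2 * δ - 1) → EuclideanSpace ℂ (Fin d),
      ‖Matrix.toEuclideanCLM (𝕜 := ℂ) (Mp a d δ) v‖ ^ 2 = ∑ j, ‖w j‖ ^ 2 ∧
      ∀ j, Real.exp (-((δ : ℝ) + 1) / a) * ((1 - Real.exp (-2 / a)) / (1 + Real.exp (-2 / a))) *
          ‖innerSlice v j‖ ≤ ‖w j‖ ∧
        ‖w j‖ ≤ Real.exp (-2 / a) * (1 - Real.exp (-2 / a))⁻¹ * ‖innerSlice v j‖ := by
  have : NeZero d := ⟨by omega⟩
  choose K p L hK1 hK2 hL hpL hblk using exists_blk_eq ha hδ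
  set r := Real.exp (-2 / a)
  have hr : 0 ≤ r := (Real.exp_pos _).le
  have hr1 : r < 1 := Real.exp_lt_one_iff.2 (div_neg_of_neg_of_pos (by norm_num) ha)
  have hK0 (j) : 0 ≤ K j := (Real.exp_pos _).le.trans (hK1 j)
  refine ⟨fun j => (K j : ℂ) • (∑ k ∈ Finset.range (L j), ((r : ℂ) • cyclicShift d) ^ k)
    ((cyclicShift d ^ p j) (innerSlice v j)), ?_, fun j => ?_⟩
  · simp_rw [← sum_range_ite_smul_pow (cyclicShift d) (K _) r (hpL _)]
    simp_rw [EuclideanSpace.norm_sq_eq]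
    rw [Fintype.sum_prod_type, Finset.sum_comm (s := Finset.univ (α := Fin (2 * δ - 1)))]
    refine Finset.sum_congr rfl fun i _ => Eq.trans ?_
      (Matrix.sum_norm_sq_mulVec_of_conjTranspose_mul_self
        (dftMatrix_conjTranspose_mul_self (by omega : 2 * δ - 1 ≠ 0)) _)
    refine Finset.sum_congr rfl fun k _ => ?_
    rw [toEuclideanCLM_Mp_apply a hd, Matrix.mulVec, dotProduct]
    congr 3
    ext j
    rw [WithLp.ofLp_sum, Finset.sum_apply, Finset.mul_sum]
    refine Finset.sum_congr rfl fun t ht => ?_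
    rw [hblk j t (Finset.mem_range.1 ht) k, PiLp.smul_apply, smul_eq_mul, mul_assoc]
  · have hS := norm_cyclicShift d
    rw [norm_smul, Complex.norm_real, Real.norm_of_nonneg (hK0 j), mul_assoc, mul_assoc]
    rw [← norm_pow_apply_of_norm_apply _ hS (p j) (innerSlice v j)]
    have h0 : 0 ≤ (1 - r) / (1 + r) := div_nonneg (by linarith) (by linarith)
    exact ⟨mul_le_mul (hK1 j) (le_norm_geom_sum_apply _ hS hr hr1 (hL j) _) (by positivity)
      (hK0 j), mul_le_mul (hK2 j) (norm_geom_sum_apply_le _ hS hr hr1 _ _) (norm_nonneg _) hr⟩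

theorem norm_toEuclideanCLM_Mp_bounds {a : ℝ} (ha : 0 < a) {d δ : ℕ} (hδ : 2 ≤ δ) (hd : δ ≤ d)
    (v : EuclideanSpace ℂ (Fin d × Fin (2 * δ - 1))) :
    Real.exp (-((δ : ℝ) + 1) / a) * ((1 - Real.exp (-2 / a)) / (1 + Real.exp (-2 / a))) * ‖v‖ ≤
        ‖Matrix.toEuclideanCLM (𝕜 := ℂ) (Mp a d δ) v‖ ∧
      ‖Matrix.toEuclideanCLM (𝕜 := ℂ) (Mp a d δ) v‖ ≤
        Real.exp (-2 / a) * (1 - Real.exp (-2 / a))⁻¹ * ‖v‖ := by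
  obtain ⟨w, hw, hb⟩ := exists_toEuclideanCLM_Mp_eq ha hδ hd v
  have hr1 : Real.exp (-2 / a) < 1 := Real.exp_lt_one_iff.2 (div_neg_of_neg_of_pos (by norm_num) ha)
  have h1 : 0 < 1 - Real.exp (-2 / a) := by linarith
  constructor
  · refine le_of_sq_le_sq ?_ (norm_nonneg _)
    rw [mul_pow, hw, ← sum_norm_sq_innerSlice, Finset.mul_sum]
    refine Finset.sum_le_sum fun j _ => ?_
    rw [← mul_pow]
    exact pow_le_pow_left₀ (by positivity) (hb j).1 2
  · refine le_of_sq_le_sq ?_ (by positivity)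
    rw [mul_pow, hw, ← sum_norm_sq_innerSlice, Finset.mul_sum]
    refine Finset.sum_le_sum fun j _ => ?_
    rw [← mul_pow]
    exact pow_le_pow_left₀ (norm_nonneg _) (hb j).2 2

theorem two_thirds_mul_le_one_sub_exp_neg {x : ℝ} (hx : 0 ≤ x) (hx1 : x ≤ 1 / 2) :
    2 / 3 * x ≤ 1 - Real.exp (-x) := by
  have h : Real.exp (-x) * (1 + x) ≤ 1 := by
    calc Real.exp (-x) * (1 + x) ≤ Real.exp (-x) * Real.exp x := by
          gcongr; linarith [Real.add_one_le_exp x]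
      _ = 1 := by rw [← Real.exp_add, neg_add_cancel, Real.exp_zero]
  nlinarith [Real.exp_pos (-x)]

theorem condition_bound_lt {a b : ℝ} (ha : 4 ≤ a) (hb : b ≤ 2 * a) :
    Real.exp (-2 / a) * (1 - Real.exp (-2 / a))⁻¹ *
        (Real.exp (-(b + 2) / a) * ((1 - Real.exp (-2 / a)) / (1 + Real.exp (-2 / a))))⁻¹ <
      9 * Real.exp 2 * a ^ 2 := by
  have ha0 : 0 < a := by linarith
  have hx : 2 / 3 * (2 / a) ≤ 1 - Real.exp (-2 / a) := by
    rw [neg_div]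
    exact two_thirds_mul_le_one_sub_exp_neg (by positivity) (by rw [div_le_iff₀ ha0]; linarith)
  have hsplit : Real.exp (-(b + 2) / a) = Real.exp (-2 / a) * (Real.exp (b / a))⁻¹ := by
    rw [← Real.exp_neg, ← Real.exp_add]; congr 1; ring
  have hb2 : Real.exp (b / a) ≤ Real.exp 2 := Real.exp_le_exp.2 ((div_le_iff₀ ha0).2 hb)
  have hr : 0 < Real.exp (-2 / a) := Real.exp_pos _
  have hr1 : Real.exp (-2 / a) < 1 := Real.exp_lt_one_iff.2 (div_neg_of_neg_of_pos (by norm_num) ha0)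
  rw [hsplit]
  generalize Real.exp (-2 / a) = r at *
  have hy : 4 / 3 ≤ a * (1 - r) := by
    have := mul_le_mul_of_nonneg_left hx ha0.le
    field_simp at this
    linarith
  have h1 : 0 < 1 - r := by linarith
  have he : 0 < Real.exp (b / a) := Real.exp_pos _
  have heq : r * (1 - r)⁻¹ * (r * (Real.exp (b / a))⁻¹ * ((1 - r) / (1 + r)))⁻¹ =
      Real.exp (b / a) * (1 + r) / (1 - r) ^ 2 := by
    field_simp
  rw [heq, div_lt_iff₀ (by positivity)]
  calc Real.exp (b / a) * (1 + r) ≤ Real.exp 2 * (1 + r) := by gcongr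
    _ < Real.exp 2 * (9 * (a * (1 - r)) ^ 2) := by gcongr; nlinarith
    _ = 9 * Real.exp 2 * a ^ 2 * (1 - r) ^ 2 := by ring

/-- For integers `2 ≤ δ`, `2δ < d` and `a := max{4, (δ−1)/2}`, the
block-circulant matrix `M'` is invertible and its `ℓ² → ℓ²` condition number satisfies
`κ(M') = ‖M'‖·‖(M')⁻¹‖ < max{144·e², (9·e²/4)·(δ−1)²}`. -/
theorem stmt_11 (δ d : ℕ) (hδ : 2 ≤ δ) (hd : 2 * δ < d) :
    IsUnit (Mp (max 4 (((δ : ℝ) - 1) / 2)) d δ) ∧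
    ‖Matrix.toEuclideanCLM (𝕜 := ℂ) (Mp (max 4 (((δ : ℝ) - 1) / 2)) d δ)‖ *
        ‖Matrix.toEuclideanCLM (𝕜 := ℂ) ((Mp (max 4 (((δ : ℝ) - 1) / 2)) d δ)⁻¹)‖
      < max (144 * Real.exp 2) (9 * Real.exp 2 / 4 * ((δ : ℝ) - 1) ^ 2) := by
  set a : ℝ := max 4 (((δ : ℝ) - 1) / 2) with ha_def
  have ha : 4 ≤ a := le_max_left _ _
  have hδa : (δ : ℝ) - 1 ≤ 2 * a := by linarith [le_max_right 4 (((δ : ℝ) - 1) / 2)]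
  have ha0 : 0 < a := by linarith
  have hr1 : Real.exp (-2 / a) < 1 := Real.exp_lt_one_iff.2 (div_neg_of_neg_of_pos (by norm_num) ha0)
  have h1 : 0 < 1 - Real.exp (-2 / a) := by linarith
  have hbd := norm_toEuclideanCLM_Mp_bounds ha0 hδ (by omega : δ ≤ d)
  obtain ⟨hunit, hle⟩ := Matrix.isUnit_and_norm_mul_norm_inv_le (Mp a d δ) (by positivity)
    (by positivity) (fun v => (hbd v).1) (fun v => (hbd v).2)
  refine ⟨hunit, hle.trans_lt ?_⟩
  have hlt := condition_bound_lt ha hδa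
  rw [show (δ : ℝ) - 1 + 2 = δ + 1 by ring] at hlt
  refine hlt.trans_le ?_
  rcases max_choice 4 (((δ : ℝ) - 1) / 2) with h | h
  · refine le_max_of_le_left (le_of_eq ?_)
    rw [ha_def, h]; ring
  · refine le_max_of_le_right (le_of_eq ?_)
    rw [ha_def, h]; ring
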